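/- For every positive integer n, the map U from compositions of n to compositions of n is a bijection, where U is defined as follows: given a composition c, append a final part 0 if c has odd length so that the parts come in consecutive pairs (c_{2i-1}, c_{2i}); replace each pair (x, y) with x > y by the sequence (1^{x-y-1}, 2y+1) (a run of x−y−1 ones followed by the part 2y+1), and replace each pair (x, y) with 2k−2 ≤ y−x < 2k for the (unique) integer k ≥ 1 by the sequence (1^{x+y-2k}, 2k); concatenate the resulting sequences in order to obtain U(c). -/

import Mathlib

/-- A composition of `n`: a list of positive integers summing to `n`. -/
def IsComposition (n : ℕ) (l : List ℕ) : Prop :=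
  (∀ x ∈ l, 0 < x) ∧ l.sum = n

/-- The image of one pair `(x, y)` of parts under the map `U`:
if `x > y` it becomes `(1^{x-y-1}, 2y+1)`; otherwise, with the unique `k ≥ 1`
such that `2k-2 ≤ y-x < 2k` (namely `k = (y-x)/2 + 1`), it becomes
`(1^{x+y-2k}, 2k)`. -/
def Ustep (x y : ℕ) : List ℕ :=
  if y < x then List.replicate (x - y - 1) 1 ++ [2 * y + 1]
  else List.replicate (x + y - 2 * ((y - x) / 2 + 1)) 1 ++ [2 * ((y - x) / 2 + 1)]

/-- The map `U`: pair up consecutive parts (appending a final `0` when the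
length is odd), apply `Ustep` to each pair, and concatenate. -/
def U : List ℕ → List ℕ
  | [] => []
  | [x] => Ustep x 0
  | x :: y :: rest => Ustep x y ++ U rest

/-- The inverse of `U`, with an accumulator `a` counting the ones already read. -/
def unfoldOnes : ℕ → List ℕ → List ℕ
  | a, [] => if a = 0 then [] else [a]
  | a, b :: t =>
    if b = 1 then unfoldOnes (a + 1) t
    else if b % 2 = 1 then (a + b / 2 + 1) :: (b / 2) :: unfoldOnes 0 t
    else (a / 2 + 1) :: (a + b - (a / 2 + 1)) :: unfoldOnes 0 t

theorem unfoldOnes_replicate_append (a m : ℕ) (t : List ℕ) :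
    unfoldOnes a (List.replicate m 1 ++ t) = unfoldOnes (a + m) t := by
  induction m generalizing a with
  | zero => simp
  | succ m ih =>
    rw [List.replicate_succ, List.cons_append, unfoldOnes, if_pos rfl, ih]
    congr 1
    omega

theorem Ustep_zero {x : ℕ} (hx : 0 < x) : Ustep x 0 = List.replicate x 1 := by
  obtain ⟨m, rfl⟩ := Nat.exists_eq_succ_of_ne_zero hx.ne'
  simp [Ustep, List.replicate_succ']

theorem Ustep_pos (x y : ℕ) : ∀ z ∈ Ustep x y, 0 < z := by
  intro z hz
  unfold Ustep at hz
  split_ifs at hz <;> simp only [List.mem_append, List.mem_replicate, List.mem_singleton] at hz <;>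
    omega

theorem Ustep_sum {x : ℕ} (y : ℕ) (hx : 0 < x) : (Ustep x y).sum = x + y := by
  unfold Ustep
  split_ifs <;> simp only [List.sum_append, List.sum_replicate, List.sum_singleton, smul_eq_mul] <;>
    omega

theorem unfoldOnes_Ustep_append {x y : ℕ} (hx : 0 < x) (hy : 0 < y) (t : List ℕ) :
    unfoldOnes 0 (Ustep x y ++ t) = x :: y :: unfoldOnes 0 t := by
  unfold Ustep
  split_ifs with h
  · rw [List.append_assoc, unfoldOnes_replicate_append, List.singleton_append, unfoldOnes,
      if_neg (by omega), if_pos (by omega)]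
    congr 1
    · omega
    · congr 1
      omega
  · rw [List.append_assoc, unfoldOnes_replicate_append, List.singleton_append, unfoldOnes,
      if_neg (by omega), if_neg (by omega)]
    congr 1
    · omega
    · congr 1
      omega

theorem U_pos (l : List ℕ) : ∀ z ∈ U l, 0 < z := by
  fun_induction U l with
  | case1 => simp
  | case2 x => exact Ustep_pos x 0
  | case3 x y rest ih =>
    intro z hz
    exact (List.mem_append.1 hz).elim (Ustep_pos x y z) (ih z)

theorem U_sum (l : List ℕ) (hl : ∀ z ∈ l, 0 < z) : (U l).sum = l.sum := by
  fun_induction U l with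
  | case1 => rfl
  | case2 x => simpa using Ustep_sum 0 (hl x (by simp))
  | case3 x y rest ih =>
    rw [List.sum_append, Ustep_sum y (hl x (by simp)), ih fun z hz => hl z (by simp [hz])]
    simp [add_assoc]

theorem unfoldOnes_U (l : List ℕ) (hl : ∀ z ∈ l, 0 < z) : unfoldOnes 0 (U l) = l := by
  fun_induction U l with
  | case1 => rfl
  | case2 x =>
    have hx := hl x (by simp)
    rw [Ustep_zero hx, ← List.append_nil (List.replicate x 1), unfoldOnes_replicate_append,
      unfoldOnes, if_neg (by omega), zero_add]
  | case3 x y rest ih =>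
    rw [unfoldOnes_Ustep_append (hl x (by simp)) (hl y (by simp)),
      ih fun z hz => hl z (by simp [hz])]

theorem unfoldOnes_pos (a : ℕ) (l : List ℕ) (hl : ∀ z ∈ l, 0 < z) :
    ∀ z ∈ unfoldOnes a l, 0 < z := by
  induction l generalizing a with
  | nil =>
    intro z hz
    unfold unfoldOnes at hz
    split_ifs at hz <;> simp at hz
    omega
  | cons b t ih =>
    have hb := hl b (by simp)
    have ht : ∀ z ∈ t, 0 < z := fun z hz => hl z (by simp [hz])
    intro z hz
    unfold unfoldOnes at hz
    split_ifs at hz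
    · exact ih _ ht z hz
    all_goals
      simp only [List.mem_cons] at hz
      rcases hz with rfl | rfl | hz
      · omega
      · omega
      · exact ih _ ht z hz

theorem U_unfoldOnes (a : ℕ) (l : List ℕ) (hl : ∀ z ∈ l, 0 < z) :
    U (unfoldOnes a l) = List.replicate a 1 ++ l := by
  induction l generalizing a with
  | nil =>
    unfold unfoldOnes
    split_ifs with h
    · simp [h, U]
    · rw [U, Ustep_zero (by omega), List.append_nil]
  | cons b t ih =>
    have hb := hl b (by simp)
    have ht : ∀ z ∈ t, 0 < z := fun z hz => hl z (by simp [hz])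
    unfold unfoldOnes
    split_ifs with h h'
    · rw [ih _ ht, h, List.replicate_succ', List.append_assoc, List.singleton_append]
    · rw [U, ih _ ht, Ustep, if_pos (by omega), show a + b / 2 + 1 - b / 2 - 1 = a by omega,
        show 2 * (b / 2) + 1 = b by omega]
      simp
    · rw [U, ih _ ht, Ustep, if_neg (by omega),
        show 2 * ((a + b - (a / 2 + 1) - (a / 2 + 1)) / 2 + 1) = b by omega,
        show a / 2 + 1 + (a + b - (a / 2 + 1)) - b = a by omega]
      simp

theorem U_bijOn (n : ℕ) (hn : 0 < n) :
    Set.BijOn U {l : List ℕ | IsComposition n l} {l : List ℕ | IsComposition n l} := by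
  refine Set.InvOn.bijOn (f' := unfoldOnes 0) ⟨fun l hl => unfoldOnes_U l hl.1, fun l hl => ?_⟩
    (fun l hl => ⟨U_pos l, (U_sum l hl.1).trans hl.2⟩)
    (fun l hl => ⟨unfoldOnes_pos 0 l hl.1, ?_⟩)
  · simpa using U_unfoldOnes 0 l hl.1
  · rw [← U_sum _ (unfoldOnes_pos 0 l hl.1), U_unfoldOnes 0 l hl.1]
    simpa using hl.2
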